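/- Corollary 1 (each estimated cluster is contained in one family). Under Assumptions 1, 2a, 3, 4, 5 and family plurality, in Ward's algorithm the following holds: for every K with binomial(J,P) ≥ K ≥ Q_fam and every cluster k of the K-cluster partition produced by the algorithm, lim_{n→∞} P( F̂_k(K) ⊆ F_q for some family F_q ) = 1. -/

import Mathlib

open MeasureTheory Filter Matrix Finset ProbabilityTheory

noncomputable section

/-- Convergence in probability, across a sequence of probability spaces `(Ω n, μ n)`,
of random elements `X n : Ω n → E` of a (pseudo)metric space to a constant `c`. -/
def TendstoInProb {Ω : ℕ → Type*} [∀ n, MeasurableSpace (Ω n)]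
    (μ : ∀ n, Measure (Ω n)) {E : Type*} [PseudoMetricSpace E]
    (X : ∀ n, Ω n → E) (c : E) : Prop :=
  ∀ ε : ℝ, 0 < ε → Tendsto (fun n => μ n {ω | ε < dist (X n ω) c}) atTop (nhds 0)

/-- Convergence in distribution (weak convergence of the laws), across a sequence of
probability spaces, of random elements `X n : Ω n → E` to a limiting measure `ν` on `E`. -/
def TendstoInDist {Ω : ℕ → Type*} [∀ n, MeasurableSpace (Ω n)]
    (μ : ∀ n, Measure (Ω n)) {E : Type*} [TopologicalSpace E] [PseudoMetricSpace E]
    [MeasurableSpace E] (X : ∀ n, Ω n → E) (ν : Measure E) : Prop :=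
  ∀ f : BoundedContinuousFunction E ℝ,
    Tendsto (fun n => ∫ ω, f (X n ω) ∂(μ n)) atTop (nhds (∫ x, f x ∂ν))

/-- `ν` is a centered (multivariate) Gaussian measure on `ι → ℝ` with covariance matrix
`C`: every linear functional pushes `ν` forward to a centered real Gaussian with the
corresponding variance. -/
def IsCenteredGaussian {ι : Type*} [Fintype ι] (ν : Measure (ι → ℝ))
    (C : Matrix ι ι ℝ) : Prop :=
  IsProbabilityMeasure ν ∧
    ∀ l : ι → ℝ, ν.map (fun x => ∑ i, l i * x i) =
      gaussianReal 0 (Real.toNNReal (l ⬝ᵥ C *ᵥ l))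

/-- A combination of `P` instruments out of `J`: a `P`-subset `[j]` of `{1,…,J}`. -/
abbrev Combo (J P : ℕ) := {S : Finset (Fin J) // S.card = P}

/-- The increasing enumeration of the instruments in the combination `S`. -/
def comboEmb {J P : ℕ} (S : Combo J P) (i : Fin P) : Fin J :=
  (S.1.orderIsoOfFin S.2 i : Fin J)

lemma combo_compl_card {J P : ℕ} (S : Combo J P) : (S.1ᶜ).card = J - P := by
  simp [Finset.card_compl, S.2]

/-- The increasing enumeration of the instruments **not** in the combination `S`. -/
def comboComplEmb {J P : ℕ} (S : Combo J P) (i : Fin (J - P)) : Fin J :=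
  ((S.1ᶜ).orderIsoOfFin (combo_compl_card S) i : Fin J)

/-- `γ_[j]`: the `P × P` submatrix of rows of `γ` corresponding to the combination `S`. -/
def rowsOf {J P : ℕ} (γ : Matrix (Fin J) (Fin P) ℝ) (S : Combo J P) :
    Matrix (Fin P) (Fin P) ℝ :=
  Matrix.of fun i k => γ (comboEmb S i) k

/-- `γ₂`: the `(J−P) × P` submatrix of rows of `γ` for instruments outside `S`. -/
def rowsOfCompl {J P : ℕ} (γ : Matrix (Fin J) (Fin P) ℝ) (S : Combo J P) :
    Matrix (Fin (J - P)) (Fin P) ℝ :=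
  Matrix.of fun i k => γ (comboComplEmb S i) k

/-- `α_[j]`: the subvector of `α` corresponding to the combination `S`. -/
def subvec {J P : ℕ} (α : Fin J → ℝ) (S : Combo J P) : Fin P → ℝ :=
  fun i => α (comboEmb S i)

/-- `α₂`: the subvector of `α` for instruments outside `S`. -/
def subvecCompl {J P : ℕ} (α : Fin J → ℝ) (S : Combo J P) : Fin (J - P) → ℝ :=
  fun i => α (comboComplEmb S i)

/-- Assumption 1: `E[z_i z_i'] = Q` is finite and of full rank. -/
def Assumption1 {J : ℕ} (Q : Matrix (Fin J) (Fin J) ℝ) : Prop := IsUnit Q.det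

/-- The linear IV model with potentially invalid instruments: for each sample size `n`,
data on a probability space `(Ω n, μ n)` generated by `y = Dβ + Zα + u`, `D = Zγ + E`. -/
structure IVModel (J P : ℕ) (Ω : ℕ → Type*) [∀ n, MeasurableSpace (Ω n)] where
  /-- the probability measure at sample size `n` -/
  μ : ∀ n, Measure (Ω n)
  /-- the `n × J` instrument matrix -/
  Z : ∀ n, Ω n → Matrix (Fin n) (Fin J) ℝ
  /-- the structural error -/
  u : ∀ n, Ω n → Fin n → ℝ
  /-- the first-stage error matrix -/
  Eps : ∀ n, Ω n → Matrix (Fin n) (Fin P) ℝ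
  /-- the causal parameter of interest -/
  β : Fin P → ℝ
  /-- the direct effects of the instruments (instrument `j` is valid iff `α j = 0`) -/
  α : Fin J → ℝ
  /-- the `J × P` first-stage coefficient matrix -/
  γ : Matrix (Fin J) (Fin P) ℝ

namespace IVModel

variable {J P : ℕ} {Ω : ℕ → Type*} [∀ n, MeasurableSpace (Ω n)] (M : IVModel J P Ω)

/-- The endogenous regressors `D = Zγ + E`. -/
def D (n : ℕ) (ω : Ω n) : Matrix (Fin n) (Fin P) ℝ := M.Z n ω * M.γ + M.Eps n ω

/-- The outcome `y = Dβ + Zα + u`. -/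
def y (n : ℕ) (ω : Ω n) : Fin n → ℝ := M.D n ω *ᵥ M.β + M.Z n ω *ᵥ M.α + M.u n ω

/-- The `n × (1 + P)` error matrix with rows `w_i = (u_i, ε_i')'`. -/
def W (n : ℕ) (ω : Ω n) : Matrix (Fin n) (Unit ⊕ Fin P) ℝ :=
  Matrix.of fun i a => Sum.elim (fun _ => M.u n ω i) (fun p => M.Eps n ω i p) a

/-- The first-stage OLS estimator `γ̂ = (Z'Z)⁻¹Z'D`. -/
def γhat (n : ℕ) (ω : Ω n) : Matrix (Fin J) (Fin P) ℝ :=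
  ((M.Z n ω)ᵀ * M.Z n ω)⁻¹ * ((M.Z n ω)ᵀ * M.D n ω)

/-- The reduced-form OLS estimator `Γ̂ = (Z'Z)⁻¹Z'y`. -/
def Γhat (n : ℕ) (ω : Ω n) : Fin J → ℝ :=
  ((M.Z n ω)ᵀ * M.Z n ω)⁻¹ *ᵥ ((M.Z n ω)ᵀ *ᵥ M.y n ω)

/-- The matrix `Ĥ` with blocks `γ̂₁, 0, γ̂₂, I` for the combination `S` (first block row:
instruments in `S`; second block row: the remaining instruments). -/
def Hhat (S : Combo J P) (n : ℕ) (ω : Ω n) :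
    Matrix (Fin P ⊕ Fin (J - P)) (Fin P ⊕ Fin (J - P)) ℝ :=
  Matrix.fromBlocks
    (Matrix.of fun i k => M.γhat n ω (comboEmb S i) k) 0
    (Matrix.of fun i k => M.γhat n ω (comboComplEmb S i) k) 1

/-- The just-identified 2SLS estimator `(β̂_[j]', α̂_[j]')' = Ĥ⁻¹ Γ̂` (with the entries of
`Γ̂` reordered so that the instruments of `S` come first), using `Z_[j]` as instruments
and the remaining instruments as controls. -/
def θhat (S : Combo J P) (n : ℕ) (ω : Ω n) : Fin P ⊕ Fin (J - P) → ℝ :=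
  (M.Hhat S n ω)⁻¹ *ᵥ fun idx => M.Γhat n ω (Sum.elim (comboEmb S) (comboComplEmb S) idx)

/-- The just-identified estimator `β̂_[j]` of `β` for combination `S`. -/
def βhat (S : Combo J P) (n : ℕ) (ω : Ω n) : Fin P → ℝ := fun i => M.θhat S n ω (Sum.inl i)

/-- The estimated coefficients `α̂_[j]` of the control instruments for combination `S`. -/
def αhat (S : Combo J P) (n : ℕ) (ω : Ω n) : Fin (J - P) → ℝ :=
  fun i => M.θhat S n ω (Sum.inr i)

/-- The inconsistency `q = γ_[j]⁻¹ α_[j]` of the just-identified estimator based on `S`;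
the probability limit of `β̂_[j]` is `β + q`. -/
def incons (S : Combo J P) : Fin P → ℝ := (rowsOf M.γ S)⁻¹ *ᵥ subvec M.α S

/-- Assumption 2a: `γ_[j]` has rank `P` (is nonsingular) for every `P`-subset `[j]`. -/
def Assumption2a : Prop := ∀ S : Combo J P, IsUnit (rowsOf M.γ S).det

/-- Assumption 3 (together with the corresponding part of Assumption 4): the errors
`w_i = (u_i, ε_i')'` are centered with finite second-moment matrix `Σ`, in the sense that
`n⁻¹ ∑ᵢ w_i →p 0` and `n⁻¹ W'W →p Σ`. -/
def Assumption3 (Sigw : Matrix (Unit ⊕ Fin P) (Unit ⊕ Fin P) ℝ) : Prop :=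
  (∀ a, TendstoInProb M.μ (fun n ω => (n : ℝ)⁻¹ * ∑ i, M.W n ω i a) 0) ∧
  (∀ a b, TendstoInProb M.μ (fun n ω => (n : ℝ)⁻¹ * ((M.W n ω)ᵀ * M.W n ω) a b) (Sigw a b))

/-- Assumption 4: `n⁻¹Z'Z →p Q`, `n⁻¹Z'u →p 0`, `n⁻¹Z'E →p 0`. -/
def Assumption4 (Q : Matrix (Fin J) (Fin J) ℝ) : Prop :=
  (∀ j k, TendstoInProb M.μ (fun n ω => (n : ℝ)⁻¹ * ((M.Z n ω)ᵀ * M.Z n ω) j k) (Q j k)) ∧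
  (∀ j, TendstoInProb M.μ (fun n ω => (n : ℝ)⁻¹ * ((M.Z n ω)ᵀ *ᵥ M.u n ω) j) 0) ∧
  (∀ j p, TendstoInProb M.μ (fun n ω => (n : ℝ)⁻¹ * ((M.Z n ω)ᵀ * M.Eps n ω) j p) 0)

/-- The CLT statistic `n^{-1/2} ∑ᵢ vec(z_i w_i')` of Assumption 5. -/
def cltStat (n : ℕ) (ω : Ω n) : (Unit ⊕ Fin P) × Fin J → ℝ :=
  fun aj => (Real.sqrt n)⁻¹ * ((M.Z n ω)ᵀ * M.W n ω) aj.2 aj.1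

/-- Assumption 5: `n^{-1/2} ∑ᵢ vec(z_i w_i') →d N(0, Σ ⊗ Q)`. -/
def Assumption5 (Q : Matrix (Fin J) (Fin J) ℝ)
    (Sigw : Matrix (Unit ⊕ Fin P) (Unit ⊕ Fin P) ℝ) : Prop :=
  ∃ ν : Measure ((Unit ⊕ Fin P) × Fin J → ℝ),
    IsCenteredGaussian ν (Matrix.kroneckerMap (· * ·) Sigw Q) ∧
    TendstoInDist M.μ M.cltStat ν

end IVModel

/-- Squared Euclidean distance between two points of `ℝ^P`. -/
def sqDist {P : ℕ} (x y : Fin P → ℝ) : ℝ := ∑ i, (x i - y i) ^ 2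

/-- The arithmetic mean of the points `x j`, `j ∈ A` (the cluster mean `S̄`). -/
def clMean {ι : Type*} {P : ℕ} (x : ι → Fin P → ℝ) (A : Finset ι) : Fin P → ℝ :=
  (A.card : ℝ)⁻¹ • ∑ j ∈ A, x j

/-- Ward's weighted squared Euclidean distance
`(|A||B|/(|A|+|B|))·‖Ā − B̄‖²` between two clusters. -/
def wardDist {ι : Type*} {P : ℕ} (x : ι → Fin P → ℝ) (A B : Finset ι) : ℝ :=
  ((A.card : ℝ) * B.card / ((A.card : ℝ) + B.card)) * sqDist (clMean x A) (clMean x B)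

/-- A partition of the (finite) index type `ι`: nonempty clusters, every index in exactly
one cluster. -/
def IsClustering {ι : Type*} (C : Finset (Finset ι)) : Prop :=
  (∀ A ∈ C, A.Nonempty) ∧ ∀ j : ι, ∃! A, A ∈ C ∧ j ∈ A

/-- One step of Ward's agglomerative algorithm: merge the two clusters minimizing the
weighted squared Euclidean distance. -/
def WardStep {ι : Type*} [DecidableEq ι] {P : ℕ} (x : ι → Fin P → ℝ)
    (C1 C2 : Finset (Finset ι)) : Prop :=
  ∃ A ∈ C1, ∃ B ∈ C1, A ≠ B ∧
    (∀ A' ∈ C1, ∀ B' ∈ C1, A' ≠ B' → wardDist x A B ≤ wardDist x A' B') ∧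
    C2 = insert (A ∪ B) ((C1.erase A).erase B)

/-- A clustering path of Ward's algorithm on the points `x j ∈ ℝ^P`, `j : ι`: `path K` is
the partition with `K` clusters; the path starts from the singleton partition and each
partition is obtained from the previous one by a Ward merging step. -/
def IsWardPath {ι : Type*} [Fintype ι] [DecidableEq ι] {P : ℕ} (x : ι → Fin P → ℝ)
    (path : ℕ → Finset (Finset ι)) : Prop :=
  path (Fintype.card ι) = Finset.univ.image (fun j => ({j} : Finset ι)) ∧
  ∀ K, 1 ≤ K → K < Fintype.card ι → WardStep x (path (K + 1)) (path K)

namespace IVModel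

variable {J P : ℕ} {Ω : ℕ → Type*} [∀ n, MeasurableSpace (Ω n)] (M : IVModel J P Ω)

/-- The (finite) family `F_q` of IV combinations whose just-identified estimators
converge to `β + q`. -/
def family (q : Fin P → ℝ) : Finset (Combo J P) :=
  Finset.univ.filter fun S : Combo J P => M.incons S = q

/-- The set `V` of valid instruments, `{j : α_j = 0}`. -/
def validSet : Finset (Fin J) := Finset.univ.filter fun j => M.α j = 0

/-- Assumption 6a (family plurality): `C(g, P) > max_{q ≠ 0} |F_q|`, where `g` is the
number of valid instruments. -/
def FamilyPlurality : Prop :=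
  ∀ q : Fin P → ℝ, q ≠ 0 → (M.family q).card < Nat.choose M.validSet.card P

end IVModel

section ProbFilter

variable {Ω : ℕ → Type*} [∀ n, MeasurableSpace (Ω n)]

/-- The filter of events whose probability tends to one, on the disjoint union of a sequence
of probability spaces. -/
def probFilter (μ : ∀ n, Measure (Ω n)) : Filter (Σ n, Ω n) where
  sets := {A | Tendsto (fun n => μ n {ω | (⟨n, ω⟩ : Σ n, Ω n) ∉ A}) atTop (nhds 0)}
  univ_sets := by simp
  sets_of_superset := by
    intro A B hA hAB
    exact tendsto_of_tendsto_of_tendsto_of_le_of_le tendsto_const_nhds hA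
      (fun n => zero_le) (fun n => measure_mono fun ω hω h => hω (hAB h))
  inter_sets := by
    intro A B hA hB
    have hsum := Tendsto.add (Set.mem_ofPred.1 hA) (Set.mem_ofPred.1 hB)
    rw [add_zero] at hsum
    refine tendsto_of_tendsto_of_tendsto_of_le_of_le tendsto_const_nhds hsum
      (fun n => zero_le) (fun n => ?_)
    refine (measure_mono fun ω hω => ?_).trans (measure_union_le _ _)
    by_cases h : (⟨n, ω⟩ : Σ n, Ω n) ∈ A
    · exact Or.inr fun h' => hω ⟨h, h'⟩
    · exact Or.inl h

variable {μ : ∀ n, Measure (Ω n)}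

lemma eventually_probFilter {p : (Σ n, Ω n) → Prop} :
    (∀ᶠ s in probFilter μ, p s) ↔
      Tendsto (fun n => μ n {ω | ¬ p ⟨n, ω⟩}) atTop (nhds 0) :=
  Iff.rfl

lemma TendstoInProb.tendsto_probFilter {E : Type*} [PseudoMetricSpace E]
    {X : ∀ n, Ω n → E} {c : E} (h : TendstoInProb μ X c) :
    Tendsto (fun s : Σ n, Ω n => X s.1 s.2) (probFilter μ) (nhds c) := by
  rw [Metric.nhds_basis_closedBall.tendsto_right_iff]
  intro ε hε
  rw [eventually_probFilter]
  simpa only [Metric.mem_closedBall, not_le] using h ε hε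

lemma tendsto_measure_one_of_eventually_probFilter (hμ : ∀ n, IsProbabilityMeasure (μ n))
    {p : (Σ n, Ω n) → Prop} (h : ∀ᶠ s in probFilter μ, p s) :
    Tendsto (fun n => μ n {ω | p ⟨n, ω⟩}) atTop (nhds 1) := by
  rw [eventually_probFilter] at h
  have hsub : Tendsto (fun n => 1 - μ n {ω | ¬ p ⟨n, ω⟩}) atTop (nhds 1) := by
    simpa using ENNReal.Tendsto.sub (tendsto_const_nhds (x := (1 : ENNReal))) h
      (Or.inl ENNReal.one_ne_top)
  refine tendsto_of_tendsto_of_tendsto_of_le_of_le hsub tendsto_const_nhds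
    (fun n => ?_) (fun n => prob_le_one)
  rw [tsub_le_iff_right, ← measure_univ (μ := μ n)]
  refine (measure_mono fun ω _ => ?_).trans (measure_union_le _ _)
  exact em (p ⟨n, ω⟩)

end ProbFilter

section MatrixLimits

variable {X : Type*} {l : Filter X} {m k : Type*} [Fintype m]

lemma Filter.Tendsto.matrix_inv [DecidableEq m] {A : X → Matrix m m ℝ} {B : Matrix m m ℝ}
    (h : Tendsto A l (nhds B)) (hB : IsUnit B.det) :
    Tendsto (fun s => (A s)⁻¹) l (nhds B⁻¹) :=
  (continuousAt_matrix_inv B (by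
    rw [Ring.inverse_eq_inv']
    exact continuousAt_inv₀ hB.ne_zero)).tendsto.comp h

lemma Filter.Tendsto.matrix_mul {n : Type*} {A : X → Matrix k m ℝ} {B : X → Matrix m n ℝ}
    {A' : Matrix k m ℝ} {B' : Matrix m n ℝ}
    (hA : Tendsto A l (nhds A')) (hB : Tendsto B l (nhds B')) :
    Tendsto (fun s => A s * B s) l (nhds (A' * B')) :=
  ((continuous_fst.matrix_mul continuous_snd).tendsto (A', B')).comp (hA.prodMk_nhds hB)

lemma Filter.Tendsto.matrix_mulVec {A : X → Matrix k m ℝ} {v : X → m → ℝ}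
    {A' : Matrix k m ℝ} {v' : m → ℝ}
    (hA : Tendsto A l (nhds A')) (hv : Tendsto v l (nhds v')) :
    Tendsto (fun s => A s *ᵥ v s) l (nhds (A' *ᵥ v')) :=
  ((continuous_fst.matrix_mulVec continuous_snd).tendsto (A', v')).comp (hA.prodMk_nhds hv)

end MatrixLimits

lemma Matrix.inv_eq_smul_inv_smul {m : Type*} [Fintype m] [DecidableEq m] {c : ℝ}
    (A : Matrix m m ℝ) (hA : IsUnit (c • A).det) : A⁻¹ = c • (c • A)⁻¹ := by
  refine Matrix.inv_eq_right_inv ?_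
  rw [Matrix.mul_smul, ← Matrix.smul_mul, Matrix.mul_nonsing_inv _ hA]

namespace IVModel

variable {J P : ℕ} {Ω : ℕ → Type*} [∀ n, MeasurableSpace (Ω n)] (M : IVModel J P Ω)
  {Q : Matrix (Fin J) (Fin J) ℝ}

lemma Assumption4.tendsto_gram (h4 : M.Assumption4 Q) :
    Tendsto (fun s : Σ n, Ω n => (s.1 : ℝ)⁻¹ • ((M.Z s.1 s.2)ᵀ * M.Z s.1 s.2))
      (probFilter M.μ) (nhds Q) :=
  tendsto_pi_nhds.2 fun j => tendsto_pi_nhds.2 fun k => (h4.1 j k).tendsto_probFilter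

lemma Assumption4.tendsto_crossD (h4 : M.Assumption4 Q) :
    Tendsto (fun s : Σ n, Ω n => (s.1 : ℝ)⁻¹ • ((M.Z s.1 s.2)ᵀ * M.D s.1 s.2))
      (probFilter M.μ) (nhds (Q * M.γ)) := by
  have hE : Tendsto (fun s : Σ n, Ω n => (s.1 : ℝ)⁻¹ • ((M.Z s.1 s.2)ᵀ * M.Eps s.1 s.2))
      (probFilter M.μ) (nhds 0) :=
    tendsto_pi_nhds.2 fun j => tendsto_pi_nhds.2 fun p => (h4.2.2 j p).tendsto_probFilter
  have hsum := (h4.tendsto_gram.matrix_mul (tendsto_const_nhds (x := M.γ))).add hE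
  rw [add_zero] at hsum
  refine hsum.congr fun s => ?_
  rw [D, Matrix.mul_add, smul_add, ← Matrix.mul_assoc, Matrix.smul_mul]

lemma Assumption4.tendsto_crossY (h4 : M.Assumption4 Q) :
    Tendsto (fun s : Σ n, Ω n => (s.1 : ℝ)⁻¹ • ((M.Z s.1 s.2)ᵀ *ᵥ M.y s.1 s.2))
      (probFilter M.μ) (nhds (Q *ᵥ (M.γ *ᵥ M.β + M.α))) := by
  have hu : Tendsto (fun s : Σ n, Ω n => (s.1 : ℝ)⁻¹ • ((M.Z s.1 s.2)ᵀ *ᵥ M.u s.1 s.2))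
      (probFilter M.μ) (nhds 0) :=
    tendsto_pi_nhds.2 fun j => (h4.2.1 j).tendsto_probFilter
  have hsum := ((h4.tendsto_crossD.matrix_mulVec (tendsto_const_nhds (x := M.β))).add
    (h4.tendsto_gram.matrix_mulVec (tendsto_const_nhds (x := M.α)))).add hu
  rw [add_zero, ← Matrix.mulVec_mulVec, ← Matrix.mulVec_add] at hsum
  refine hsum.congr fun s => ?_
  rw [y, Matrix.mulVec_add, Matrix.mulVec_add, smul_add, smul_add, Matrix.smul_mulVec,
    Matrix.smul_mulVec, Matrix.mulVec_mulVec, Matrix.mulVec_mulVec]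

lemma Assumption4.eventually_inv_gram (h4 : M.Assumption4 Q) (h1 : Assumption1 Q) :
    ∀ᶠ s : Σ n, Ω n in probFilter M.μ, ((M.Z s.1 s.2)ᵀ * M.Z s.1 s.2)⁻¹ =
      (s.1 : ℝ)⁻¹ • ((s.1 : ℝ)⁻¹ • ((M.Z s.1 s.2)ᵀ * M.Z s.1 s.2))⁻¹ := by
  have hdet := ((continuous_id.matrix_det).tendsto Q).comp h4.tendsto_gram
  filter_upwards [hdet.eventually_ne (IsUnit.ne_zero h1)] with s hd
  exact Matrix.inv_eq_smul_inv_smul _ (isUnit_iff_ne_zero.2 hd)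

lemma Assumption4.tendsto_γhat (h4 : M.Assumption4 Q) (h1 : Assumption1 Q) :
    Tendsto (fun s : Σ n, Ω n => M.γhat s.1 s.2) (probFilter M.μ) (nhds M.γ) := by
  have h := (h4.tendsto_gram.matrix_inv h1).matrix_mul h4.tendsto_crossD
  rw [Matrix.nonsing_inv_mul_cancel_left _ _ h1] at h
  refine h.congr' ?_
  filter_upwards [h4.eventually_inv_gram M h1] with s hs
  rw [γhat, hs, Matrix.mul_smul, Matrix.smul_mul]

lemma Assumption4.tendsto_Γhat (h4 : M.Assumption4 Q) (h1 : Assumption1 Q) :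
    Tendsto (fun s : Σ n, Ω n => M.Γhat s.1 s.2) (probFilter M.μ)
      (nhds (M.γ *ᵥ M.β + M.α)) := by
  have h := (h4.tendsto_gram.matrix_inv h1).matrix_mulVec h4.tendsto_crossY
  rw [Matrix.mulVec_mulVec, Matrix.nonsing_inv_mul _ h1, Matrix.one_mulVec] at h
  refine h.congr' ?_
  filter_upwards [h4.eventually_inv_gram M h1] with s hs
  rw [Γhat, hs, Matrix.mulVec_smul, Matrix.smul_mulVec]

lemma fromBlocks_mulVec_plim (S : Combo J P) (h : IsUnit (rowsOf M.γ S).det) :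
    Matrix.fromBlocks (rowsOf M.γ S) 0 (rowsOfCompl M.γ S) (1 : Matrix (Fin (J - P)) _ ℝ) *ᵥ
        Sum.elim (M.β + M.incons S) (subvecCompl M.α S - rowsOfCompl M.γ S *ᵥ M.incons S) =
      fun idx => (M.γ *ᵥ M.β + M.α) (Sum.elim (comboEmb S) (comboComplEmb S) idx) := by
  have hq : rowsOf M.γ S *ᵥ M.incons S = subvec M.α S := by
    rw [incons, Matrix.mulVec_mulVec, Matrix.mul_nonsing_inv _ h, Matrix.one_mulVec]
  rw [Matrix.fromBlocks_mulVec]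
  ext (i | i)
  · simp only [Sum.elim_inl, Sum.elim_comp_inl, Sum.elim_comp_inr, Matrix.zero_mulVec, add_zero,
      Matrix.mulVec_add, hq]
    rfl
  · simp only [Sum.elim_inr, Sum.elim_comp_inl, Sum.elim_comp_inr, Matrix.one_mulVec,
      Matrix.mulVec_add, add_assoc, add_sub_cancel]
    rfl

/-- Consistency of the just-identified estimator for `β + γ_[j]⁻¹ α_[j]`. -/
lemma Assumption4.tendsto_βhat (h4 : M.Assumption4 Q) (h1 : Assumption1 Q) (S : Combo J P)
    (h : IsUnit (rowsOf M.γ S).det) :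
    Tendsto (fun s : Σ n, Ω n => M.βhat S s.1 s.2) (probFilter M.μ)
      (nhds (M.β + M.incons S)) := by
  set H := Matrix.fromBlocks (rowsOf M.γ S) 0 (rowsOfCompl M.γ S)
    (1 : Matrix (Fin (J - P)) (Fin (J - P)) ℝ) with hH
  have hdet : IsUnit H.det := by
    rwa [hH, Matrix.det_fromBlocks_zero₁₂, Matrix.det_one, mul_one]
  have hγ (i : Fin J) (k : Fin P) := ((h4.tendsto_γhat M h1).apply_nhds i).apply_nhds k
  have hHhat : Tendsto (fun s : Σ n, Ω n => M.Hhat S s.1 s.2) (probFilter M.μ) (nhds H) := by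
    refine tendsto_pi_nhds.2 fun a => tendsto_pi_nhds.2 fun b => ?_
    rcases a with i | i <;> rcases b with k | k
    · exact hγ _ k
    · exact tendsto_const_nhds
    · exact hγ _ k
    · exact tendsto_const_nhds
  have hΓ : Tendsto (fun (s : Σ n, Ω n) idx =>
      M.Γhat s.1 s.2 (Sum.elim (comboEmb S) (comboComplEmb S) idx)) (probFilter M.μ)
      (nhds fun idx => (M.γ *ᵥ M.β + M.α) (Sum.elim (comboEmb S) (comboComplEmb S) idx)) :=
    tendsto_pi_nhds.2 fun idx => (h4.tendsto_Γhat M h1).apply_nhds _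
  have hθ := (hHhat.matrix_inv hdet).matrix_mulVec hΓ
  rw [← M.fromBlocks_mulVec_plim S h, Matrix.mulVec_mulVec, Matrix.nonsing_inv_mul _ hdet,
    Matrix.one_mulVec] at hθ
  exact tendsto_pi_nhds.2 fun i => hθ.apply_nhds (Sum.inl i)

end IVModel

section Ward

variable {ι : Type*} {P : ℕ}

lemma sqDist_self (x : Fin P → ℝ) : sqDist x x = 0 := by simp [sqDist]

lemma sqDist_nonneg (x y : Fin P → ℝ) : 0 ≤ sqDist x y :=
  Finset.sum_nonneg fun _ _ => sq_nonneg _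

lemma sqDist_eq_zero {x y : Fin P → ℝ} : sqDist x y = 0 ↔ x = y := by
  rw [sqDist, Finset.sum_eq_zero_iff_of_nonneg fun _ _ => sq_nonneg _]
  simp [sub_eq_zero, funext_iff]

lemma clMean_eq_of_forall_eq {x : ι → Fin P → ℝ} {A : Finset ι} {c : Fin P → ℝ}
    (hA : A.Nonempty) (h : ∀ j ∈ A, x j = c) : clMean x A = c := by
  have hcard : (A.card : ℝ) ≠ 0 := Nat.cast_ne_zero.2 hA.card_ne_zero
  rw [clMean, Finset.sum_congr rfl h, Finset.sum_const, ← Nat.cast_smul_eq_nsmul ℝ,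
    inv_smul_smul₀ hcard]

lemma clMean_eq_of_wardDist_nonpos {x : ι → Fin P → ℝ} {A B : Finset ι} (hA : A.Nonempty)
    (hB : B.Nonempty) (h : wardDist x A B ≤ 0) : clMean x A = clMean x B := by
  have hA' : (0 : ℝ) < A.card := Nat.cast_pos.2 hA.card_pos
  have hB' : (0 : ℝ) < B.card := Nat.cast_pos.2 hB.card_pos
  have hpos : (0 : ℝ) < (A.card : ℝ) * B.card / ((A.card : ℝ) + B.card) := by positivity
  exact sqDist_eq_zero.1 (le_antisymm (nonpos_of_mul_nonpos_right h hpos) (sqDist_nonneg _ _))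

lemma continuous_wardDist (A B : Finset ι) :
    Continuous fun x : ι → Fin P → ℝ => wardDist x A B := by
  unfold wardDist sqDist clMean
  fun_prop

/-- A family of points close enough to `b` ranks Ward distances that differ at `b` in the
same way as `b` does. -/
lemma eventually_wardDist_lt [Finite ι] {X : Type*} {l : Filter X} {x : X → ι → Fin P → ℝ}
    {b : ι → Fin P → ℝ} (hx : Tendsto x l (nhds b)) :
    ∀ᶠ s in l, ∀ A B A' B' : Finset ι, wardDist b A B < wardDist b A' B' →
      wardDist (x s) A B < wardDist (x s) A' B' := by
  have hw (A B : Finset ι) := ((continuous_wardDist A B).tendsto b).comp hx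
  simp only [eventually_all]
  exact fun A B A' B' h => (hw A B).eventually_lt (hw A' B') h

/-- `C` consists of `K` nonempty disjoint clusters on each of which `b` is constant. -/
structure IsHomogeneousClustering (b : ι → Fin P → ℝ) (K : ℕ) (C : Finset (Finset ι)) :
    Prop where
  card_eq : C.card = K
  nonempty : ∀ A ∈ C, A.Nonempty
  disjoint : (C : Set (Finset ι)).PairwiseDisjoint id
  homogeneous : ∀ A ∈ C, ∀ i ∈ A, ∀ j ∈ A, b i = b j

variable {b : ι → Fin P → ℝ}

lemma IsHomogeneousClustering.clMean_eq {K : ℕ} {C : Finset (Finset ι)}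
    (h : IsHomogeneousClustering b K C) {A : Finset ι} (hA : A ∈ C) {i : ι} (hi : i ∈ A) :
    clMean b A = b i :=
  clMean_eq_of_forall_eq ⟨i, hi⟩ fun j hj => h.homogeneous A hA j hj i hi

variable [DecidableEq ι]

lemma isHomogeneousClustering_singletons [Fintype ι] (b : ι → Fin P → ℝ) :
    IsHomogeneousClustering b (Fintype.card ι)
      (Finset.univ.image fun j : ι => ({j} : Finset ι)) where
  card_eq := Finset.card_image_of_injective _ Finset.singleton_injective
  nonempty := by simp
  disjoint := by
    rintro A hA B hB hAB
    obtain ⟨i, rfl⟩ : ∃ i, {i} = A := by simpa using hA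
    obtain ⟨j, rfl⟩ : ∃ j, {j} = B := by simpa using hB
    simpa [Function.onFun] using hAB
  homogeneous := by simp

lemma IsHomogeneousClustering.merge {K : ℕ} {C : Finset (Finset ι)}
    (h : IsHomogeneousClustering b (K + 1) C) {A B : Finset ι} (hA : A ∈ C) (hB : B ∈ C)
    (hAB : A ≠ B) (hmean : clMean b A = clMean b B) :
    IsHomogeneousClustering b K (insert (A ∪ B) ((C.erase A).erase B)) := by
  have hdisj : ∀ D ∈ (C.erase A).erase B, Disjoint (A ∪ B) D := by
    intro D hD
    simp only [Finset.mem_erase] at hD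
    exact Finset.disjoint_union_left.2
      ⟨h.disjoint hA hD.2.2 hD.2.1.symm, h.disjoint hB hD.2.2 hD.1.symm⟩
  have hne : (A ∪ B).Nonempty := (h.nonempty A hA).mono Finset.subset_union_left
  have hval : ∀ i ∈ A ∪ B, b i = clMean b A := by
    intro i hi
    rcases Finset.mem_union.1 hi with hi | hi
    · exact (h.clMean_eq hA hi).symm
    · exact hmean ▸ (h.clMean_eq hB hi).symm
  refine ⟨?_, ?_, ?_, ?_⟩
  · have hnot : A ∪ B ∉ (C.erase A).erase B := fun hmem =>
      hne.ne_empty (disjoint_self.1 (hdisj _ hmem))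
    rw [Finset.card_insert_of_notMem hnot,
      Finset.card_erase_of_mem (Finset.mem_erase.2 ⟨hAB.symm, hB⟩), Finset.card_erase_of_mem hA,
      h.card_eq]
    have : 1 < C.card := Finset.one_lt_card.2 ⟨A, hA, B, hB, hAB⟩
    have := h.card_eq
    omega
  · intro D hD
    rcases Finset.mem_insert.1 hD with rfl | hD
    · exact hne
    · exact h.nonempty D (Finset.mem_of_mem_erase (Finset.mem_of_mem_erase hD))
  · rw [Finset.coe_insert]
    refine Set.PairwiseDisjoint.insert (h.disjoint.subset ?_) fun D hD _ => hdisj D hD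
    exact Finset.coe_subset.2 ((Finset.erase_subset _ _).trans (Finset.erase_subset _ _))
  · intro D hD i hi j hj
    rcases Finset.mem_insert.1 hD with rfl | hD
    · rw [hval i hi, hval j hj]
    · exact h.homogeneous D (Finset.mem_of_mem_erase (Finset.mem_of_mem_erase hD)) i hi j hj

/-- As long as there are more clusters than values of `b`, a Ward step on points that rank
distances consistently with `b` merges two clusters sharing their value of `b`. -/
lemma IsHomogeneousClustering.wardStep [Fintype ι] {K : ℕ} {C C' : Finset (Finset ι)}
    (h : IsHomogeneousClustering b (K + 1) C) (hK : (Finset.univ.image b).card ≤ K)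
    {x : ι → Fin P → ℝ}
    (hx : ∀ A B A' B' : Finset ι, wardDist b A B < wardDist b A' B' →
      wardDist x A B < wardDist x A' B')
    (hstep : WardStep x C C') : IsHomogeneousClustering b K C' := by
  obtain ⟨A, hA, B, hB, hAB, hmin, rfl⟩ := hstep
  have hmaps : ∀ D ∈ C, clMean b D ∈ Finset.univ.image b := by
    intro D hD
    obtain ⟨i, hi⟩ := h.nonempty D hD
    rw [h.clMean_eq hD hi]
    exact Finset.mem_image_of_mem b (Finset.mem_univ i)
  have hcard := h.card_eq
  obtain ⟨A', hA', B', hB', hne, heq⟩ :=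
    Finset.exists_ne_map_eq_of_card_lt_of_maps_to (by omega) hmaps
  have hzero : wardDist b A' B' = 0 := by rw [wardDist, heq, sqDist_self, mul_zero]
  have hle : wardDist b A B ≤ 0 := by
    rw [← hzero]
    exact not_lt.1 fun hlt => (hmin A' hA' B' hB' hne).not_gt (hx _ _ _ _ hlt)
  exact h.merge hA hB hAB (clMean_eq_of_wardDist_nonpos (h.nonempty A hA) (h.nonempty B hB) hle)

lemma IsWardPath.isHomogeneousClustering [Fintype ι] [Nonempty ι] {x : ι → Fin P → ℝ}
    {path : ℕ → Finset (Finset ι)} (hpath : IsWardPath x path)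
    (hx : ∀ A B A' B' : Finset ι, wardDist b A B < wardDist b A' B' →
      wardDist x A B < wardDist x A' B')
    {K : ℕ} (hbK : (Finset.univ.image b).card ≤ K) (hK : K ≤ Fintype.card ι) :
    IsHomogeneousClustering b K (path K) := by
  refine Nat.decreasingInduction' (fun k hk hKk ih => ?_) hK
    (hpath.1 ▸ isHomogeneousClustering_singletons b)
  have hb : (Finset.univ.image b).card ≤ k := hbK.trans hKk
  have hpos : 0 < (Finset.univ.image b).card :=
    Finset.card_pos.2 (Finset.univ_nonempty.image b)
  exact ih.wardStep hb hx (hpath.2 k (hpos.trans_le hb) hk)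

end Ward

/-- **Corollary 1: each estimated cluster is contained in one family.**  Under
Assumptions 1, 2a, 3, 4, 5 and family plurality, along the clustering path of Ward's
algorithm applied to the just-identified estimates, for every number of clusters `K` with
`C(J,P) ≥ K ≥ Q_fam`, with probability tending to one every cluster of the `K`-cluster
partition is contained in some family `F_q`. -/
theorem corollary1_each_cluster_within_a_family
    {J P : ℕ} (hPJ : P < J) {Ω : ℕ → Type*} [∀ n, MeasurableSpace (Ω n)]
    (M : IVModel J P Ω) (hprob : ∀ n, IsProbabilityMeasure (M.μ n))
    (Q : Matrix (Fin J) (Fin J) ℝ) (Sigw : Matrix (Unit ⊕ Fin P) (Unit ⊕ Fin P) ℝ)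
    (h1 : Assumption1 Q) (h2a : M.Assumption2a)
    (h3 : M.Assumption3 Sigw) (h4 : M.Assumption4 Q) (h5 : M.Assumption5 Q Sigw)
    (h6a : M.FamilyPlurality)
    (path : ∀ n, Ω n → ℕ → Finset (Finset (Combo J P)))
    (hpath : ∀ n ω, IsWardPath (fun S => M.βhat S n ω) (path n ω))
    (Qfam : ℕ) (hQfam : Qfam = (Finset.univ.image M.incons).card)
    (K : ℕ) (hKQ : Qfam ≤ K) (hKJ : K ≤ Fintype.card (Combo J P)) :
    Tendsto
      (fun n => M.μ n {ω | ∀ C ∈ path n ω K, ∃ q : Fin P → ℝ, C ⊆ M.family q})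
      atTop (nhds 1) := by
  have : Nonempty (Combo J P) := by
    obtain ⟨S, -, hS⟩ := Finset.exists_subset_card_eq (s := (Finset.univ : Finset (Fin J)))
      (n := P) (by simpa using hPJ.le)
    exact ⟨⟨S, hS⟩⟩
  have hβ : Tendsto (fun (s : Σ n, Ω n) S => M.βhat S s.1 s.2) (probFilter M.μ)
      (nhds fun S => M.β + M.incons S) :=
    tendsto_pi_nhds.2 fun S => h4.tendsto_βhat M h1 S (h2a S)
  have hcard : (Finset.univ.image fun S => M.β + M.incons S).card ≤ K := by
    have himage := Finset.card_image_of_injective (Finset.univ.image M.incons)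
      (add_right_injective M.β)
    rw [Finset.image_image] at himage
    exact himage.trans_le (hQfam ▸ hKQ)
  refine tendsto_measure_one_of_eventually_probFilter (p := fun s : Σ n, Ω n =>
    ∀ C ∈ path s.1 s.2 K, ∃ q : Fin P → ℝ, C ⊆ M.family q) hprob ?_
  filter_upwards [eventually_wardDist_lt hβ] with s hs C hC
  have hclust := (hpath s.1 s.2).isHomogeneousClustering hs hcard hKJ
  obtain ⟨S, hS⟩ := hclust.nonempty C hC
  refine ⟨M.incons S, fun T hT => ?_⟩
  simpa [IVModel.family] using hclust.homogeneous C hC T hT S hS
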